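/- Let p be an odd prime and n a positive integer. If (π₁, V₁) and (π₂, V₂) are two irreducible finite-dimensional complex representations of the finite Heisenberg group H having the same nontrivial central character ψ (that is, πᵢ(0,t) = ψ(t)·Id for all t ∈ F_p, i = 1,2), then π₁ and π₂ are isomorphic. -/

import Mathlib

open scoped BigOperators

namespace RK

/-- The standard symplectic form `ω(v,w) = ∑ᵢ (vᵢ w_{n+i} - v_{n+i} wᵢ)`. -/
def ω {R : Type*} [CommRing R] {n : ℕ} (v w : Fin n ⊕ Fin n → R) : R :=
  ∑ i : Fin n, (v (Sum.inl i) * w (Sum.inr i) - v (Sum.inr i) * w (Sum.inl i))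

lemma ω_add_left {R : Type*} [CommRing R] {n : ℕ} (u v w : Fin n ⊕ Fin n → R) :
    ω (u + v) w = ω u w + ω v w := by
  simp only [ω, Pi.add_apply, ← Finset.sum_add_distrib]
  exact Finset.sum_congr rfl fun i _ => by ring

lemma ω_add_right {R : Type*} [CommRing R] {n : ℕ} (u v w : Fin n ⊕ Fin n → R) :
    ω u (v + w) = ω u v + ω u w := by
  simp only [ω, Pi.add_apply, ← Finset.sum_add_distrib]
  exact Finset.sum_congr rfl fun i _ => by ring

@[simp] lemma ω_zero_left {R : Type*} [CommRing R] {n : ℕ} (w : Fin n ⊕ Fin n → R) :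
    ω 0 w = 0 := by simp [ω]

@[simp] lemma ω_zero_right {R : Type*} [CommRing R] {n : ℕ} (v : Fin n ⊕ Fin n → R) :
    ω v 0 = 0 := by simp [ω]

@[simp] lemma ω_neg_left {R : Type*} [CommRing R] {n : ℕ} (v w : Fin n ⊕ Fin n → R) :
    ω (-v) w = - ω v w := by
  simp only [ω, Pi.neg_apply, ← Finset.sum_neg_distrib]
  exact Finset.sum_congr rfl fun i _ => by ring

@[simp] lemma ω_self {R : Type*} [CommRing R] {n : ℕ} (v : Fin n ⊕ Fin n → R) :
    ω v v = 0 := by simp [ω, mul_comm]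

/-- `F_p^{2n}`, with coordinates indexed by `Fin n ⊕ Fin n`. -/
abbrev Vec (p n : ℕ) := Fin n ⊕ Fin n → ZMod p

/-- The finite Heisenberg group `H = F_p^{2n} × F_p`. -/
@[ext]
structure Heis (p n : ℕ) where
  v : Vec p n
  t : ZMod p

/-- `ν = (p+1)/2`, the inverse of `2` mod `p`. -/
def ν (p : ℕ) : ZMod p := ((p + 1) / 2 : ℕ)

instance {p n : ℕ} : Mul (Heis p n) :=
  ⟨fun a b => ⟨a.v + b.v, a.t + b.t + ν p * ω a.v b.v⟩⟩
instance {p n : ℕ} : One (Heis p n) := ⟨⟨0, 0⟩⟩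
instance {p n : ℕ} : Inv (Heis p n) := ⟨fun a => ⟨-a.v, -a.t⟩⟩

lemma Heis.mul_def {p n : ℕ} (a b : Heis p n) :
    a * b = ⟨a.v + b.v, a.t + b.t + ν p * ω a.v b.v⟩ := rfl
lemma Heis.one_def {p n : ℕ} : (1 : Heis p n) = ⟨0, 0⟩ := rfl
lemma Heis.inv_def {p n : ℕ} (a : Heis p n) : a⁻¹ = ⟨-a.v, -a.t⟩ := rfl

instance {p n : ℕ} : Group (Heis p n) where
  mul := (· * ·)
  one := 1
  inv := Inv.inv
  mul_assoc a b c := by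
    simp only [Heis.mul_def, ω_add_left, ω_add_right, Heis.mk.injEq]
    exact ⟨add_assoc _ _ _, by ring⟩
  one_mul a := by simp [Heis.mul_def, Heis.one_def]
  mul_one a := by simp [Heis.mul_def, Heis.one_def]
  inv_mul_cancel a := by simp [Heis.mul_def, Heis.inv_def, Heis.one_def]

/-- The symplectic group `Sp(2n, F_p)`: invertible matrices preserving `ω`. -/
def Sp (p n : ℕ) : Subgroup ((Matrix (Fin n ⊕ Fin n) (Fin n ⊕ Fin n) (ZMod p))ˣ) where
  carrier := {A | ∀ v w : Vec p n, ω (A.val.mulVec v) (A.val.mulVec w) = ω v w}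
  one_mem' := by
    intro v w
    simp [Matrix.one_mulVec]
  mul_mem' := by
    intro A B hA hB v w
    simp only [Units.val_mul, ← Matrix.mulVec_mulVec]
    rw [hA, hB]
  inv_mem' := by
    intro A hA v w
    have h := hA (A⁻¹.val.mulVec v) (A⁻¹.val.mulVec w)
    rw [Matrix.mulVec_mulVec, Matrix.mulVec_mulVec, Units.mul_inv, Matrix.one_mulVec,
      Matrix.one_mulVec] at h
    exact h.symm

/-- The matrix underlying an element of `Sp(2n, F_p)`. -/
def Sp.mat {p n : ℕ} (A : Sp p n) : Matrix (Fin n ⊕ Fin n) (Fin n ⊕ Fin n) (ZMod p) :=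
  (A : (Matrix (Fin n ⊕ Fin n) (Fin n ⊕ Fin n) (ZMod p))ˣ).val

/-- The Egorov identity: `ρ(g) π(v,t) ρ(g)⁻¹ = π(gv, t)`. -/
def Egorov {p n : ℕ} {V : Type*} [AddCommGroup V] [Module ℂ V]
    (π : Representation ℂ (Heis p n) V) (ρ : Sp p n → (Module.End ℂ V)ˣ) : Prop :=
  ∀ (g : Sp p n) (v : Vec p n) (t : ZMod p),
    (ρ g : Module.End ℂ V) * π ⟨v, t⟩ * ((ρ g)⁻¹ : (Module.End ℂ V)ˣ) =
      π ⟨(Sp.mat g).mulVec v, t⟩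

/-- Irreducibility of a representation: `V ≠ 0` and the only invariant subspaces are `⊥` and `⊤`. -/
def IsIrreducibleRep {G : Type*} [Monoid G] {V : Type*} [AddCommGroup V] [Module ℂ V]
    (π : Representation ℂ G V) : Prop :=
  (∃ x : V, x ≠ 0) ∧
    ∀ W : Submodule ℂ V, (∀ (g : G) (x : V), x ∈ W → π g x ∈ W) → W = ⊥ ∨ W = ⊤

noncomputable instance {p n : ℕ} [NeZero p] : Fintype (Sp p n) := Fintype.ofFinite _

noncomputable instance {p n : ℕ} [NeZero p] (H : Subgroup (Sp p n)) : Fintype H :=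
  Fintype.ofFinite _

end RK

namespace RK

lemma two_mul_ν {p : ℕ} [Fact p.Prime] (hp : p ≠ 2) : 2 * ν p = 1 := by
  have hodd : Odd p := (Fact.out : p.Prime).odd_of_ne_two hp
  obtain ⟨k, hk⟩ := hodd
  have h1 : 2 * ((p + 1) / 2) = p + 1 := by omega
  have h2 : ((2 * ((p + 1) / 2) : ℕ) : ZMod p) = ((p + 1 : ℕ) : ZMod p) := by rw [h1]
  push_cast at h2
  simpa [ν] using h2

lemma ω_swap {R : Type*} [CommRing R] {n : ℕ} (v w : Fin n ⊕ Fin n → R) :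
    ω v w = - ω w v := by
  simp only [ω, ← Finset.sum_neg_distrib]
  exact Finset.sum_congr rfl fun i _ => by ring

/-- The symplectic form is nondegenerate. -/
lemma exists_ω_eq {F : Type*} [Field F] {n : ℕ} (v : Fin n ⊕ Fin n → F) (hv : v ≠ 0) (r : F) :
    ∃ w, ω w v = r := by
  obtain ⟨i, hi⟩ := Function.ne_iff.mp hv
  rcases i with i | i
  · refine ⟨Pi.single (Sum.inr i) (-r / v (Sum.inl i)), ?_⟩
    simp only [Pi.zero_apply] at hi
    simp [ω, Pi.single_apply, hi]
  · refine ⟨Pi.single (Sum.inl i) (r / v (Sum.inr i)), ?_⟩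
    simp only [Pi.zero_apply] at hi
    simp [ω, Pi.single_apply, hi]

lemma conj_eq {p n : ℕ} [Fact p.Prime] (hp : p ≠ 2) (w v : Vec p n) (s : ZMod p) :
    (⟨w, 0⟩ : Heis p n) * ⟨v, s⟩ * (⟨w, 0⟩ : Heis p n)⁻¹ = ⟨0, ω w v⟩ * ⟨v, s⟩ := by
  have h := two_mul_ν (p := p) hp
  have hr : ω v (-w) = ω w v := by rw [ω_swap, ω_neg_left, neg_neg]
  have hs : ω w (-w) = 0 := by rw [ω_swap, ω_neg_left, ω_self]; simp
  simp only [Heis.mul_def, Heis.inv_def, ω_add_left, ω_zero_left, hr, hs, Heis.mk.injEq]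
  refine ⟨by abel, ?_⟩
  linear_combination ω w v * h

section
variable {p n : ℕ} [Fact p.Prime] {V : Type*} [AddCommGroup V] [Module ℂ V]
  [FiniteDimensional ℂ V] (π : Representation ℂ (Heis p n) V) (ψ : ZMod p → ℂ)

lemma char_eq_zero (hp : p ≠ 2) (hψ : ∀ s : ZMod p, π ⟨0, s⟩ = ψ s • (1 : Module.End ℂ V))
    (hψnt : ∃ s, ψ s ≠ 1) (g : Heis p n) (hg : g.v ≠ 0) : π.character g = 0 := by
  obtain ⟨r, hr⟩ := hψnt
  obtain ⟨w, hw⟩ := exists_ω_eq g.v hg r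
  have h1 := π.char_conj g ⟨w, 0⟩
  have h2 := conj_eq hp w g.v g.t
  rw [show (⟨g.v, g.t⟩ : Heis p n) = g from rfl] at h2
  rw [h2, hw] at h1
  have h3 : ψ r * π.character g = π.character g := by
    refine Eq.trans ?_ h1
    simp [Representation.character, map_mul, hψ]
  have h4 : (ψ r - 1) * π.character g = 0 := by rw [sub_mul, h3]; ring
  exact (mul_eq_zero.mp h4).resolve_left (sub_ne_zero.mpr hr)

lemma char_center (hψ : ∀ s : ZMod p, π ⟨0, s⟩ = ψ s • (1 : Module.End ℂ V)) (s : ZMod p) :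
    π.character ⟨0, s⟩ = ψ s * Module.finrank ℂ V := by
  simp [Representation.character, hψ]

lemma ψ_mul_neg (hψ : ∀ s : ZMod p, π ⟨0, s⟩ = ψ s • (1 : Module.End ℂ V))
    (hV : ∃ x : V, x ≠ 0) (s : ZMod p) : ψ s * ψ (-s) = 1 := by
  obtain ⟨x, hx⟩ := hV
  have h : π ⟨0, s⟩ * π ⟨0, -s⟩ = 1 := by
    rw [← map_mul, ← map_one π]
    congr 1
    simp [Heis.mul_def, Heis.one_def]
  rw [hψ, hψ] at h
  have h2 := congrArg (fun f : Module.End ℂ V => f x) h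
  simp only [smul_mul_smul_comm, one_mul, LinearMap.smul_apply, Module.End.one_apply] at h2
  have h3 : (ψ s * ψ (-s) - 1) • x = 0 := by rw [sub_smul, h2, one_smul, sub_self]
  exact sub_eq_zero.mp ((smul_eq_zero.mp h3).resolve_right hx)

end

/-- Stone–von Neumann uniqueness — two irreducible representations of the finite
Heisenberg group with the same nontrivial central character are isomorphic. -/
theorem stone_von_neumann {p n : ℕ} [Fact p.Prime] (hp : p ≠ 2) (hn : 0 < n)
    {V₁ V₂ : Type*} [AddCommGroup V₁] [Module ℂ V₁] [FiniteDimensional ℂ V₁]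
    [AddCommGroup V₂] [Module ℂ V₂] [FiniteDimensional ℂ V₂]
    (π₁ : Representation ℂ (Heis p n) V₁) (hπ₁ : IsIrreducibleRep π₁)
    (π₂ : Representation ℂ (Heis p n) V₂) (hπ₂ : IsIrreducibleRep π₂)
    (ψ : ZMod p → ℂ)
    (hψ₁ : ∀ s : ZMod p, π₁ ⟨0, s⟩ = ψ s • (1 : Module.End ℂ V₁))
    (hψ₂ : ∀ s : ZMod p, π₂ ⟨0, s⟩ = ψ s • (1 : Module.End ℂ V₂))
    (hψnt : ∃ s, ψ s ≠ 1) :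
    ∃ T : V₁ ≃ₗ[ℂ] V₂, ∀ (h : Heis p n) (x : V₁), T (π₁ h x) = π₂ h (T x) := by
  classical
  have : Finite (Heis p n) := Finite.of_injective (fun g : Heis p n => (g.v, g.t))
    (fun a b h => by
      have h := Prod.mk.inj h
      exact Heis.ext h.1 h.2)
  letI : Fintype (Heis p n) := Fintype.ofFinite _
  have hcard : (Nat.card (Heis p n) : ℂ) ≠ 0 := Nat.cast_ne_zero.mpr Nat.card_pos.ne'
  letI : Invertible (Nat.card (Heis p n) : ℂ) := invertibleOfNonzero hcard
  have key := Representation.card_inv_mul_sum_char_mul_char_eq_finrank π₁ π₂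
  have hterm : ∀ g : Heis p n, π₂.character g * π₁.character g⁻¹ =
      if g.v = 0 then (Module.finrank ℂ V₂ * Module.finrank ℂ V₁ : ℂ) else 0 := by
    rintro ⟨v, s⟩
    split_ifs with hv
    · simp only at hv
      subst hv
      rw [Heis.inv_def]
      simp only [neg_zero]
      rw [char_center π₂ ψ hψ₂, char_center π₁ ψ hψ₁]
      have := ψ_mul_neg π₁ ψ hψ₁ hπ₁.1 s
      linear_combination (Module.finrank ℂ V₂ * Module.finrank ℂ V₁ : ℂ) * this
    · rw [char_eq_zero π₂ ψ hp hψ₂ hψnt _ hv, zero_mul]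
  have hne : ∃ f : Representation.IntertwiningMap π₁ π₂, f ≠ 0 := by
    by_contra! hall
    have hsub : Subsingleton (Representation.IntertwiningMap π₁ π₂) :=
      ⟨fun a b => by rw [hall a, hall b]⟩
    rw [Module.finrank_zero_of_subsingleton, Finset.sum_congr rfl (fun g _ => hterm g),
      Finset.sum_ite, Finset.sum_const_zero, Finset.sum_const, add_zero, nsmul_eq_mul,
      Nat.cast_zero] at key
    obtain ⟨x₁, hx₁⟩ := hπ₁.1
    obtain ⟨x₂, hx₂⟩ := hπ₂.1
    have : Nontrivial V₁ := ⟨x₁, 0, hx₁⟩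
    have : Nontrivial V₂ := ⟨x₂, 0, hx₂⟩
    have hd₁ : (Module.finrank ℂ V₁ : ℂ) ≠ 0 := Nat.cast_ne_zero.mpr Module.finrank_pos.ne'
    have hd₂ : (Module.finrank ℂ V₂ : ℂ) ≠ 0 := Nat.cast_ne_zero.mpr Module.finrank_pos.ne'
    have hc : ((Finset.univ.filter (fun g : Heis p n => g.v = 0)).card : ℂ) ≠ 0 := by
      refine Nat.cast_ne_zero.mpr (Finset.card_pos.mpr ⟨1, ?_⟩).ne'
      simp [Heis.one_def]
    exact mul_ne_zero (inv_ne_zero hcard) (mul_ne_zero hc (mul_ne_zero hd₂ hd₁)) key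
  obtain ⟨f, hf⟩ := hne
  have hf0 : f.toLinearMap ≠ 0 := fun h => hf (Representation.IntertwiningMap.ext h)
  have hfi : ∀ g x, f.toLinearMap (π₁ g x) = π₂ g (f.toLinearMap x) :=
    fun g x => LinearMap.congr_fun (f.isIntertwining' g) x
  have hker : LinearMap.ker f.toLinearMap = ⊥ := by
    refine (hπ₁.2 _ fun g x hx => ?_).resolve_right fun h => hf0 (LinearMap.ker_eq_top.mp h)
    rw [LinearMap.mem_ker] at hx ⊢
    rw [hfi, hx, map_zero]
  have hrange : LinearMap.range f.toLinearMap = ⊤ := by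
    refine (hπ₂.2 _ fun g x hx => ?_).resolve_left fun h => hf0 (LinearMap.range_eq_bot.mp h)
    obtain ⟨y, rfl⟩ := hx
    exact ⟨π₁ g y, hfi g y⟩
  exact ⟨LinearEquiv.ofBijective f.toLinearMap
    ⟨LinearMap.ker_eq_bot.mp hker, LinearMap.range_eq_top.mp hrange⟩, hfi⟩

end RK
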